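/- Let n ≥ 2 and m ≥ 1 be integers. A function f : (ℤ/nℤ)^m → ℤ/nℤ is representable by a polynomial in m variables over ℤ/nℤ if and only if f belongs to the ℤ/nℤ-submodule of functions (ℤ/nℤ)^m → ℤ/nℤ spanned by the tensor-product generators, i.e., the functions (x₁, …, x_m) ↦ u_{p₁,j₁}^{<k₁>}(x₁) · u_{p₂,j₂}^{<k₂>}(x₂) · … · u_{p_m,j_m}^{<k_m>}(x_m), ranging over all choices where each p_i is a prime dividing n, 0 ≤ j_i < e_{p_i} (the exponent of p_i in n), and 0 ≤ k_i < p_i. -/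

import Mathlib

/-- The function `u_{p,j} : ℤ/nℤ → ℤ/nℤ`, equal to `(n/p^e)·a^j` (with `e` the
exponent of `p` in `n`, and `n/p^e` taken modulo `n`) when `p` divides the least
nonnegative residue of `a`, and `0` otherwise. -/
def upj (n p j : ℕ) : ZMod n → ZMod n :=
  fun a => if p ∣ a.val then ((n / p ^ n.factorization p : ℕ) : ZMod n) * a ^ j else 0

theorem aux_N_mul (n p : ℕ) : n / p ^ n.factorization p * p ^ n.factorization p = n :=
  Nat.div_mul_cancel (Nat.ordProj_dvd n p)

theorem aux_zero (n p t : ℕ) (hn : 2 ≤ n) (a : ZMod n) (ha : p ∣ a.val)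
    (ht : n.factorization p ≤ t) :
    ((n / p ^ n.factorization p : ℕ) : ZMod n) * a ^ t = 0 := by
  haveI : NeZero n := ⟨by omega⟩
  have h : ((n / p ^ n.factorization p * a.val ^ t : ℕ) : ZMod n) = 0 := by
    rw [ZMod.natCast_eq_zero_iff]
    conv_lhs => rw [← aux_N_mul n p]
    exact Nat.mul_dvd_mul_left _ ((pow_dvd_pow p ht).trans (pow_dvd_pow_of_dvd ha t))
  push_cast at h
  rwa [ZMod.natCast_zmod_val] at h

theorem aux_one (n p s : ℕ) (hn : 2 ≤ n) (hp : p.Prime) (a : ZMod n) (ha : ¬ p ∣ a.val) :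
    ((n / p ^ n.factorization p : ℕ) : ZMod n) *
      a ^ ((p ^ n.factorization p).totient * s) =
    ((n / p ^ n.factorization p : ℕ) : ZMod n) := by
  haveI : NeZero n := ⟨by omega⟩
  have h : ((n / p ^ n.factorization p * a.val ^ ((p ^ n.factorization p).totient * s) : ℕ)
      : ZMod n) = ((n / p ^ n.factorization p * 1 : ℕ) : ZMod n) := by
    rw [ZMod.natCast_eq_natCast_iff]
    have h1 : a.val ^ (p ^ n.factorization p).totient ≡ 1 [MOD p ^ n.factorization p] :=
      Nat.ModEq.pow_totient (((Nat.Prime.coprime_iff_not_dvd hp).2 ha).symm.pow_right _)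
    have h2 := (h1.pow s).mul_left' (n / p ^ n.factorization p)
    rw [aux_N_mul, ← pow_mul, one_pow] at h2
    exact h2
  push_cast at h
  rwa [ZMod.natCast_zmod_val, mul_one] at h

theorem aux_upj_eq (n p j : ℕ) (hn : 2 ≤ n) (hp : p.Prime) (a : ZMod n) :
    upj n p j a = ((n / p ^ n.factorization p : ℕ) : ZMod n) *
      (1 - a ^ ((p ^ n.factorization p).totient * n.factorization p)) * a ^ j := by
  unfold upj
  split_ifs with h
  · rw [mul_sub, aux_zero n p ((p ^ n.factorization p).totient * n.factorization p) hn a h,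
      mul_one, sub_zero]
    exact Nat.le_mul_of_pos_left _ (Nat.totient_pos.2 (pow_pos hp.pos _))
  · rw [mul_sub, aux_one n p _ hn hp a h, mul_one, sub_self, zero_mul]

theorem aux_bezout (n : ℕ) (hn : 2 ≤ n) :
    ∃ c : ℕ → ZMod n, ∑ p ∈ n.primeFactors,
      c p * ((n / p ^ n.factorization p : ℕ) : ZMod n) = 1 := by
  have h : Pairwise fun i j : n.primeFactors =>
      IsCoprime (((i : ℕ) : ℤ) ^ n.factorization i) (((j : ℕ) : ℤ) ^ n.factorization j) := by
    intro i j hij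
    apply IsCoprime.pow
    rw [Nat.isCoprime_iff_coprime]
    exact (Nat.coprime_primes (Nat.prime_of_mem_primeFactors i.2)
      (Nat.prime_of_mem_primeFactors j.2)).2 (fun h => hij (Subtype.ext h))
  obtain ⟨μ, hμ⟩ := (exists_sum_eq_one_iff_pairwise_coprime (t := n.primeFactors)
    (s := fun i : ℕ => (i : ℤ) ^ n.factorization i)
    (Nat.nonempty_primeFactors.2 (by omega))).2 h
  refine ⟨fun p => (μ p : ZMod n), ?_⟩
  have h3 := congrArg (Int.cast : ℤ → ZMod n) hμ
  push_cast at h3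
  rw [← h3]
  refine Finset.sum_congr rfl fun p hp => ?_
  congr 1
  have h4 : n / p ^ n.factorization p = ∏ q ∈ n.primeFactors \ {p}, q ^ n.factorization q := by
    apply Nat.div_eq_of_eq_mul_right
      (pow_pos (Nat.prime_of_mem_primeFactors hp).pos _)
    rw [← Finset.prod_eq_mul_prod_sdiff_singleton_of_mem hp
      (fun q => q ^ n.factorization q)]
    exact (Nat.prod_factorization_pow_eq_self (by omega)).symm
  rw [h4]
  push_cast
  rfl

/-- local expansion of a power near a residue class mod `p` -/
theorem aux_binom (n p d k : ℕ) (hn : 2 ≤ n) (x : ZMod n) (hx : p ∣ (x - (k : ZMod n)).val) :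
    ∑ j ∈ Finset.range (n.factorization p),
      ((d.choose j : ZMod n) * (k : ZMod n) ^ (d - j)) * upj n p j (x - k) =
    ((n / p ^ n.factorization p : ℕ) : ZMod n) * x ^ d := by
  set e := n.factorization p with he
  set N := ((n / p ^ e : ℕ) : ZMod n) with hN
  have key : x ^ d = ∑ j ∈ Finset.range (d + 1),
      (x - (k : ZMod n)) ^ j * (k : ZMod n) ^ (d - j) * (d.choose j : ZMod n) := by
    rw [← add_pow, sub_add_cancel]
  have e1 : ∑ j ∈ Finset.range (d + 1),
      (x - (k : ZMod n)) ^ j * (k : ZMod n) ^ (d - j) * (d.choose j : ZMod n) =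
      ∑ j ∈ Finset.range (d + 1 + e),
      (x - (k : ZMod n)) ^ j * (k : ZMod n) ^ (d - j) * (d.choose j : ZMod n) := by
    apply Finset.sum_subset
    · intro j; simp only [Finset.mem_range]; omega
    · intro j _ hj
      simp only [Finset.mem_range, not_lt] at hj
      rw [Nat.choose_eq_zero_of_lt (by omega)]; simp
  rw [key, e1, Finset.mul_sum]
  have e2 : ∑ j ∈ Finset.range e,
      ((d.choose j : ZMod n) * (k : ZMod n) ^ (d - j)) * upj n p j (x - k) =
      ∑ j ∈ Finset.range e,
      N * ((x - (k : ZMod n)) ^ j * (k : ZMod n) ^ (d - j) * (d.choose j : ZMod n)) := by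
    refine Finset.sum_congr rfl fun j _ => ?_
    rw [upj, if_pos hx, ← he, ← hN]; ring
  rw [e2]
  apply Finset.sum_subset
  · intro j; simp only [Finset.mem_range]; omega
  · intro j _ hj
    simp only [Finset.mem_range, not_lt] at hj
    rw [← mul_assoc, ← mul_assoc, aux_zero n p j hn _ hx hj]; simp

theorem aux_dvd_iff (n p k : ℕ) (hn : 2 ≤ n) (hp : p.Prime) (hpn : p ∣ n) (x : ZMod n)
    (hk : k < p) : p ∣ (x - (k : ZMod n)).val ↔ k = x.val % p := by
  haveI : NeZero n := ⟨by omega⟩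
  have h1 : ∀ y : ZMod n, (y.val : ZMod p) = ZMod.castHom hpn (ZMod p) y := by
    intro y
    conv_rhs => rw [← ZMod.natCast_zmod_val y]
    rw [map_natCast]
  rw [← ZMod.natCast_eq_zero_iff, h1, map_sub, ← h1, map_natCast, sub_eq_zero,
    ZMod.natCast_eq_natCast_iff]
  unfold Nat.ModEq
  rw [Nat.mod_eq_of_lt hk]
  exact eq_comm

def auxSet (n : ℕ) : Set (ZMod n → ZMod n) :=
  {h | ∃ p j k : ℕ, (p.Prime ∧ p ∣ n ∧ j < n.factorization p ∧ k < p) ∧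
    h = fun x => upj n p j (x - (k : ZMod n))}

theorem aux_pow_mem (n d : ℕ) (hn : 2 ≤ n) :
    (fun x : ZMod n => x ^ d) ∈ Submodule.span (ZMod n) (auxSet n) := by
  obtain ⟨c, hc⟩ := aux_bezout n hn
  have h : (fun x : ZMod n => x ^ d) = ∑ p ∈ n.primeFactors, ∑ k ∈ Finset.range p,
      ∑ j ∈ Finset.range (n.factorization p),
        (c p * ((d.choose j : ZMod n) * (k : ZMod n) ^ (d - j))) •
          (fun x => upj n p j (x - (k : ZMod n))) := by
    funext x
    simp only [Finset.sum_apply, Pi.smul_apply, smul_eq_mul]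
    conv_lhs => rw [← one_mul (x ^ d), ← hc, Finset.sum_mul]
    refine Finset.sum_congr rfl fun p hp => ?_
    have hpp := Nat.prime_of_mem_primeFactors hp
    have hpn := Nat.dvd_of_mem_primeFactors hp
    have hlt : x.val % p < p := Nat.mod_lt _ hpp.pos
    rw [Finset.sum_eq_single (x.val % p)]
    · rw [mul_assoc, ← aux_binom n p d (x.val % p) hn x
        ((aux_dvd_iff n p _ hn hpp hpn x hlt).2 rfl), Finset.mul_sum]
      exact Finset.sum_congr rfl fun j _ => by ring
    · intro k hk hne
      refine Finset.sum_eq_zero fun j _ => ?_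
      rw [upj, if_neg, mul_zero]
      rwa [aux_dvd_iff n p k hn hpp hpn x (Finset.mem_range.1 hk)]
    · intro h; exact absurd (Finset.mem_range.2 hlt) h
  rw [h]
  refine Submodule.sum_mem _ fun p hp => Submodule.sum_mem _ fun k hk =>
    Submodule.sum_mem _ fun j hj => Submodule.smul_mem _ _ (Submodule.subset_span ?_)
  exact ⟨p, j, k, ⟨Nat.prime_of_mem_primeFactors hp, Nat.dvd_of_mem_primeFactors hp,
    Finset.mem_range.1 hj, Finset.mem_range.1 hk⟩, rfl⟩

theorem aux_tensor {R : Type*} [CommRing R] {m : ℕ} (S : Set (R → R)) (F : Fin m → R → R)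
    (hF : ∀ i, F i ∈ Submodule.span R S) :
    (fun x : Fin m → R => ∏ i, F i (x i)) ∈ Submodule.span R
      {h : (Fin m → R) → R | ∃ u : Fin m → R → R, (∀ i, u i ∈ S) ∧
        h = fun x => ∏ i, u i (x i)} := by
  have h1 : ∀ i, ∃ (N : ℕ) (c : Fin N → R) (g : Fin N → S),
      ∑ t, c t • (g t : R → R) = F i := fun i => Submodule.mem_span_set'.1 (hF i)
  choose N c g hg using h1
  have h2 : (fun x : Fin m → R => ∏ i, F i (x i)) =
      ∑ t ∈ Fintype.piFinset (fun i => (Finset.univ : Finset (Fin (N i)))),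
        (∏ i, c i (t i)) • (fun x : Fin m → R => ∏ i, (g i (t i) : R → R) (x i)) := by
    funext x
    simp only [Finset.sum_apply, Pi.smul_apply, smul_eq_mul, ← Finset.prod_mul_distrib]
    rw [← Finset.prod_univ_sum (fun i => (Finset.univ : Finset (Fin (N i))))
      (fun i t => c i t * (g i t : R → R) (x i))]
    refine Finset.prod_congr rfl fun i _ => ?_
    rw [← hg i]
    simp
  rw [h2]
  exact Submodule.sum_mem _ fun t _ => Submodule.smul_mem _ _ (Submodule.subset_span
    ⟨fun i => g i (t i), fun i => (g i (t i)).2, rfl⟩)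

theorem multivar_polyFun_iff_mem_span_tensor (n m : ℕ) (hn : 2 ≤ n) (hm : 1 ≤ m)
    (f : (Fin m → ZMod n) → ZMod n) :
    (∃ g : MvPolynomial (Fin m) (ZMod n), ∀ x : Fin m → ZMod n,
        MvPolynomial.eval x g = f x) ↔
    f ∈ Submodule.span (ZMod n)
      {h : (Fin m → ZMod n) → ZMod n | ∃ p j k : Fin m → ℕ,
        (∀ i : Fin m, (p i).Prime ∧ p i ∣ n ∧
          j i < n.factorization (p i) ∧ k i < p i) ∧
        h = fun x => ∏ i : Fin m, upj n (p i) (j i) (x i - ((k i : ℕ) : ZMod n))} := by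
  constructor
  · rintro ⟨g, hg⟩
    have h : f = ∑ d ∈ g.support, g.coeff d • (fun x : Fin m → ZMod n => ∏ i, x i ^ d i) := by
      funext x
      rw [← hg x, MvPolynomial.eval_eq']
      simp
    rw [h]
    refine Submodule.sum_mem _ fun d _ => Submodule.smul_mem _ _ ?_
    refine Submodule.span_mono ?_ (aux_tensor (auxSet n) (fun i x => x ^ d i)
      (fun i => aux_pow_mem n (d i) hn))
    rintro h ⟨u, hu, rfl⟩
    choose p j k hpjk hu using hu
    refine ⟨p, j, k, hpjk, ?_⟩
    funext x
    exact Finset.prod_congr rfl fun i _ => by rw [hu i]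
  · intro hf
    induction hf using Submodule.span_induction with
    | mem h hh =>
      obtain ⟨p, j, k, hpjk, rfl⟩ := hh
      refine ⟨∏ i, (MvPolynomial.C ((n / p i ^ n.factorization (p i) : ℕ) : ZMod n) *
        (1 - (MvPolynomial.X i - MvPolynomial.C (k i : ZMod n)) ^
          ((p i ^ n.factorization (p i)).totient * n.factorization (p i))) *
        (MvPolynomial.X i - MvPolynomial.C (k i : ZMod n)) ^ j i), fun x => ?_⟩
      rw [map_prod]
      refine Finset.prod_congr rfl fun i _ => ?_
      rw [aux_upj_eq n (p i) (j i) hn (hpjk i).1]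
      simp only [map_mul, map_sub, map_pow, map_one, MvPolynomial.eval_C, MvPolynomial.eval_X]
    | zero => exact ⟨0, fun x => by simp⟩
    | add a b _ _ ha hb =>
      obtain ⟨g, hg⟩ := ha
      obtain ⟨g', hg'⟩ := hb
      exact ⟨g + g', fun x => by simp [hg, hg']⟩
    | smul r a _ ha =>
      obtain ⟨g, hg⟩ := ha
      exact ⟨MvPolynomial.C r * g, fun x => by simp [hg]⟩
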